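/- Let q ≥ 0, 1 ≤ t ≤ 2^q and k ≥ 2 be integers, let m = 2^{q+1} − t and d = 2^q·(k+1) − t. Then for any m masses μ_1, …, μ_m on ℝ^d there exist k hyperplanes H_1, …, H_k in ℝ^d such that any 2 of the k hyperplanes equipartition each μ_i; that is, for every pair 1 ≤ i < j ≤ k and every mass μ_r, each of the four regions H_i^± ∩ H_j^± has μ_r-measure μ_r(ℝ^d)/4. -/

import Mathlib

open MeasureTheory RealInnerProductSpace

noncomputable section

/-- The closed half-space determined by the hyperplane `{x | ⟪a, x⟫ = b}`:
`true` corresponds to `H⁺ = {x | ⟪a, x⟫ ≥ b}`, `false` to `H⁻ = {x | ⟪a, x⟫ ≤ b}`. -/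
def halfSpace {d : ℕ} (a : EuclideanSpace ℝ (Fin d)) (b : ℝ) (ε : Bool) :
    Set (EuclideanSpace ℝ (Fin d)) :=
  if ε then {x | b ≤ ⟪a, x⟫} else {x | ⟪a, x⟫ ≤ b}

/-- The region `⋂ i ∈ s, H i ^ (ε i)` determined by the hyperplanes indexed by `s`. -/
def region {d k : ℕ} (a : Fin k → EuclideanSpace ℝ (Fin d)) (b : Fin k → ℝ)
    (s : Finset (Fin k)) (ε : Fin k → Bool) : Set (EuclideanSpace ℝ (Fin d)) :=
  ⋂ i ∈ s, halfSpace (a i) (b i) (ε i)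


namespace BU
open Finset Function

/-- Sum over a box, singling out one coordinate. -/
lemma sum_split {ι β R : Type*} [Fintype ι] [DecidableEq ι] [DecidableEq β] [AddCommMonoid R]
    (t : ι → Finset β) (i : ι) (b : β) (G : (ι → β) → R) :
    ∑ z ∈ Fintype.piFinset t, G z =
      ∑ z ∈ Fintype.piFinset (update t i {b}), ∑ a ∈ t i, G (update z i a) := by
  rw [← Finset.sum_product']
  refine Finset.sum_nbij' (fun z => (update z i b, z i)) (fun p => update p.1 i p.2) ?_ ?_ ?_ ?_ ?_
  · intro z hz
    simp only [Fintype.mem_piFinset, mem_product] at hz ⊢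
    refine ⟨fun j => ?_, hz i⟩
    by_cases h : j = i
    · subst h; simp
    · simpa [h] using hz j
  · rintro ⟨z, a⟩ hz
    simp only [Fintype.mem_piFinset, mem_product] at hz ⊢
    intro j
    by_cases h : j = i
    · subst h; simpa using hz.2
    · simpa [h] using hz.1 j
  · intro z hz; simp
  · rintro ⟨z, a⟩ hz
    simp only [Fintype.mem_piFinset, mem_product] at hz
    have := hz.1 i
    simp at this
    simp [← this]
  · intro z hz; simp

lemma sum_symm_zero {ι : Type*} [DecidableEq ι] [Fintype ι] (G : ι → ι → ZMod 2)
    (hs : ∀ i j, G i j = G j i) (hd : ∀ i, G i i = 0) : ∑ i, ∑ j, G i j = 0 := by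
  rw [← Finset.sum_product']
  refine Finset.sum_involution (fun p _ => (p.2, p.1)) ?_ ?_ ?_ ?_
  · rintro ⟨i, j⟩ _
    simp only
    rw [hs j i]; exact CharTwo.add_self_eq_zero _
  · rintro ⟨i, j⟩ _ h e
    simp only [Prod.mk.injEq] at e
    rw [e.1] at h
    exact h (hd _)
  · simp
  · simp

/-- telescoping -/
lemma telescope (lo : ℤ) (hlo : Even lo) (N : ℕ) (h : ℤ → ZMod 2) :
    ∑ a ∈ (Icc lo (lo + 2 * N)).filter (fun a => Odd a), (h (a + 1) + h (a - 1))
      = h (lo + 2 * N) + h lo := by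
  induction N with
  | zero =>
    have : (Icc lo (lo + 2 * (0:ℕ))).filter (fun a => Odd a) = ∅ := by
      ext a
      simp only [mem_filter, mem_Icc, notMem_empty, iff_false]
      rintro ⟨h1, h2⟩
      have : a = lo := by push_cast at h1; omega
      subst this
      exact (Int.not_odd_iff_even.mpr hlo) h2
    rw [this]
    simp [CharTwo.add_self_eq_zero]
  | succ N ih =>
    have : (Icc lo (lo + 2 * (N + 1 : ℕ))).filter (fun a => Odd a) =
        insert (lo + 2 * N + 1) ((Icc lo (lo + 2 * N)).filter (fun a => Odd a)) := by
      ext a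
      simp only [mem_filter, mem_Icc, mem_insert]
      push_cast
      rw [Int.odd_iff]
      rw [Int.even_iff] at hlo
      omega
    rw [this, sum_insert (by simp), ih]
    have e1 : lo + 2 * (N:ℤ) + 1 + 1 = lo + 2 * ((N + 1 : ℕ) : ℤ) := by push_cast; ring
    have e2 : lo + 2 * (N:ℤ) + 1 - 1 = lo + 2 * N := by ring
    rw [e1, e2, add_assoc, ← add_assoc (h (lo + 2 * N)), CharTwo.add_self_eq_zero, zero_add]

variable {D k : ℕ}

/-- the mod 2 boundary operator on one block -/
def bd : ((Fin D → ℤ) → ZMod 2) →ₗ[ZMod 2] ((Fin D → ℤ) → ZMod 2) where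
  toFun F y := ∑ c, if Odd (y c) then F (y + Pi.single c 1) + F (y + Pi.single c (-1)) else 0
  map_add' F G := by
    ext y
    simp only [Pi.add_apply, ← Finset.sum_add_distrib]
    refine Finset.sum_congr rfl fun c _ => ?_
    split_ifs
    · ring
    · simp
  map_smul' r F := by
    ext y
    simp [Finset.mul_sum, mul_add]

lemma bd_apply (F : (Fin D → ℤ) → ZMod 2) (y : Fin D → ℤ) :
    bd F y = ∑ c, if Odd (y c) then F (y + Pi.single c 1) + F (y + Pi.single c (-1)) else 0 := rfl

/-- shift of a multi-cell -/
def sh (p : Fin k × Fin D) (e : ℤ) : Fin k → Fin D → ℤ := Pi.single p.1 (Pi.single p.2 e)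

lemma sh_self (p : Fin k × Fin D) (e : ℤ) : sh p e p.1 p.2 = e := by simp [sh]

lemma sh_ne (p q : Fin k × Fin D) (h : p ≠ q) (e : ℤ) : sh p e q.1 q.2 = 0 := by
  obtain ⟨i, c⟩ := p
  obtain ⟨j, c'⟩ := q
  by_cases hi : i = j
  · subst hi
    have : c' ≠ c := fun h' => h (by rw [h'])
    simp [sh, this]
  · simp [sh, Pi.single_eq_of_ne (Ne.symm hi)]

/-- the mod 2 boundary operator on products -/
def Bd (F : (Fin k → Fin D → ℤ) → ZMod 2) (z : Fin k → Fin D → ℤ) : ZMod 2 :=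
  ∑ p : Fin k × Fin D, if Odd (z p.1 p.2) then F (z + sh p 1) + F (z + sh p (-1)) else 0

lemma Bd_eq (F : (Fin k → Fin D → ℤ) → ZMod 2) (z : Fin k → Fin D → ℤ) :
    Bd F z = ∑ i, bd (fun y => F (update z i y)) (z i) := by
  unfold Bd
  rw [Fintype.sum_prod_type]
  refine Finset.sum_congr rfl fun i _ => ?_
  rw [bd_apply]
  refine Finset.sum_congr rfl fun c _ => ?_
  have : ∀ e, update z i (z i + Pi.single c e) = z + sh (i, c) e := by
    intro e
    ext j c'
    by_cases hj : j = i
    · subst hj; simp [sh]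
    · simp [sh, hj]
  simp only [this]

lemma Bd_Bd (F : (Fin k → Fin D → ℤ) → ZMod 2) (z : Fin k → Fin D → ℤ) : Bd (Bd F) z = 0 := by
  have key : Bd (Bd F) z = ∑ p : Fin k × Fin D, ∑ q : Fin k × Fin D,
      (if p ≠ q ∧ Odd (z p.1 p.2) ∧ Odd (z q.1 q.2) then
        F (z + sh p 1 + sh q 1) + F (z + sh p 1 + sh q (-1)) +
        (F (z + sh p (-1) + sh q 1) + F (z + sh p (-1) + sh q (-1))) else 0) := by
    rw [Bd]
    refine Finset.sum_congr rfl fun p _ => ?_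
    split_ifs with hp
    · rw [Bd, Bd, ← Finset.sum_add_distrib]
      refine Finset.sum_congr rfl fun q _ => ?_
      by_cases hpq : p = q
      · subst hpq
        have h1 : ¬ Odd (z p.1 p.2 + 1) := by
          rw [Int.odd_iff] at *; omega
        have h2 : ¬ Odd (z p.1 p.2 + -1) := by
          rw [Int.odd_iff] at *; omega
        simp only [Pi.add_apply, sh_self, h1, h2]
        simp
      · by_cases hq : Odd (z q.1 q.2)
        · simp only [Pi.add_apply, sh_ne p q hpq, add_zero, hq, hp]
          simp [hpq]
        · simp only [Pi.add_apply, sh_ne p q hpq, add_zero, hq]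
          simp
    · symm
      refine Finset.sum_eq_zero fun q _ => ?_
      simp [hp]
  rw [key]
  apply sum_symm_zero
  · intro p q
    simp only [add_right_comm z (sh p _) (sh q _)]
    refine if_congr ?_ ?_ rfl
    · rw [ne_comm]; tauto
    · abel
  · intro p; simp

lemma bd_bd (F : (Fin D → ℤ) → ZMod 2) : bd (bd F) = 0 := by
  ext y
  have := Bd_Bd (k := 1) (fun z => F (z 0)) (fun _ => y)
  simpa [Bd_eq] using this

lemma bd_neg (F : (Fin D → ℤ) → ZMod 2) (y : Fin D → ℤ) :
    bd F (-y) = bd (fun y => F (-y)) y := by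
  rw [bd_apply, bd_apply]
  refine Finset.sum_congr rfl fun c _ => ?_
  simp only [Pi.neg_apply, odd_neg, neg_add, ← Pi.single_neg, neg_neg]
  rw [add_comm (F _)]

/-- odd integers in `[-2 * M, 2 * M]` -/
def oddI (M : ℕ) : Finset ℤ := (Icc (-(2 * (M:ℤ))) (2 * M)).filter (fun a => Odd a)
def oddP (M : ℕ) : Finset ℤ := (Icc 0 (2 * (M:ℤ))).filter (fun a => Odd a)

def tB (M n : ℕ) (j : Fin D) : Finset ℤ := if j.val < n then oddI M else {0}
def tP (M n : ℕ) (j : Fin D) : Finset ℤ :=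
  if j.val < n then oddI M else if j.val = n then oddP M else {0}

def B (M n : ℕ) : Finset (Fin D → ℤ) := Fintype.piFinset (tB M n)
def P (M n : ℕ) : Finset (Fin D → ℤ) := Fintype.piFinset (tP M n)

lemma neg_oddI {M : ℕ} {a : ℤ} : -a ∈ oddI M ↔ a ∈ oddI M := by
  simp only [oddI, mem_filter, mem_Icc, odd_neg]
  constructor <;> rintro ⟨⟨_, _⟩, h⟩ <;> exact ⟨⟨by omega, by omega⟩, h⟩

lemma neg_B {M n : ℕ} {y : Fin D → ℤ} : -y ∈ B M n ↔ y ∈ B M n := by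
  simp only [B, Fintype.mem_piFinset, Pi.neg_apply]
  refine forall_congr' fun j => ?_
  unfold tB
  split_ifs
  · exact neg_oddI
  · simp

lemma sum_B_neg (M n : ℕ) (F : (Fin D → ℤ) → ZMod 2) :
    ∑ y ∈ B M n, F (-y) = ∑ y ∈ B M n, F y := by
  refine Finset.sum_nbij' (fun y => -y) (fun y => -y) ?_ ?_ ?_ ?_ ?_
  · intro y hy; exact neg_B.mpr hy
  · intro y hy; exact neg_B.mpr hy
  · simp
  · simp
  · simp

lemma sum_B_succ (M n : ℕ) (hn : n < D) (G : (Fin D → ℤ) → ZMod 2) :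
    ∑ y ∈ B M (n + 1), G y = ∑ y ∈ P M n, (G y + G (-y)) := by
  rw [Finset.sum_add_distrib, ← Finset.sum_filter_add_sum_filter_not (B M (n + 1))
    (fun y => 0 < y ⟨n, hn⟩)]
  have hmem : ∀ y : Fin D → ℤ, (y ∈ B M (n+1) ∧ 0 < y ⟨n, hn⟩) ↔ y ∈ P M n := by
    intro y
    simp only [B, P, Fintype.mem_piFinset]
    constructor
    · rintro ⟨h1, h2⟩ j
      have := h1 j
      unfold tB at this
      unfold tP
      by_cases hj : j.val < n
      · rw [if_pos (by omega)] at this; rwa [if_pos hj]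
      · rw [if_neg hj]
        by_cases hj2 : j.val = n
        · rw [if_pos (by omega)] at this
          rw [if_pos hj2]
          have e : j = ⟨n, hn⟩ := Fin.ext hj2
          subst e
          simp only [oddI, oddP, mem_filter, mem_Icc] at this ⊢
          exact ⟨⟨by omega, this.1.2⟩, this.2⟩
        · rw [if_neg (by omega)] at this; rwa [if_neg hj2]
    · intro h1
      constructor
      · intro j
        have := h1 j
        unfold tP at this
        unfold tB
        by_cases hj : j.val < n
        · rw [if_pos hj] at this; rwa [if_pos (by omega)]
        · rw [if_neg hj] at this
          by_cases hj2 : j.val = n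
          · rw [if_pos hj2] at this
            rw [if_pos (by omega)]
            simp only [oddI, oddP, mem_filter, mem_Icc] at this ⊢
            exact ⟨⟨by omega, this.1.2⟩, this.2⟩
          · rw [if_neg hj2] at this; rwa [if_neg (by omega)]
      · have := h1 ⟨n, hn⟩
        simp only [tP, lt_self_iff_false, if_false, if_true, oddP, mem_filter, mem_Icc] at this
        obtain ⟨⟨h3, _⟩, h4⟩ := this
        rw [Int.odd_iff] at h4
        omega
  have hnz : ∀ y : Fin D → ℤ, y ∈ B M (n+1) → y ⟨n, hn⟩ ≠ 0 := by
    intro y hy h0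
    simp only [B, Fintype.mem_piFinset] at hy
    have := hy ⟨n, hn⟩
    simp only [tB, Nat.lt_succ_self, if_true, oddI, mem_filter, h0] at this
    simp at this
  congr 1
  · refine Finset.sum_congr ?_ fun _ _ => rfl
    ext y
    rw [mem_filter, hmem]
  · refine Finset.sum_nbij' (fun y => -y) (fun y => -y) ?_ ?_ ?_ ?_ ?_
    · intro y hy
      rw [mem_filter] at hy
      rw [← hmem]
      refine ⟨neg_B.mpr hy.1, ?_⟩
      have := hnz y hy.1
      have h2 := hy.2
      simp only [Pi.neg_apply]; omega
    · intro y hy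
      rw [← hmem] at hy
      rw [mem_filter]
      refine ⟨neg_B.mpr hy.1, ?_⟩
      simp only [Pi.neg_apply]; omega
    · simp
    · simp
    · simp

/-- the hemisphere chain as a functional -/
def Df (M n : ℕ) : ((Fin D → ℤ) → ZMod 2) →ₗ[ZMod 2] ZMod 2 where
  toFun F := ∑ y ∈ P M n, bd F y + ∑ y ∈ B M n, F y
  map_add' F G := by
    simp only [map_add, Pi.add_apply, Finset.sum_add_distrib]
    ring
  map_smul' r F := by
    simp only [map_smul, Pi.smul_apply, smul_eq_mul, ← Finset.mul_sum, RingHom.id_apply, mul_add]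

lemma Df_apply (M n : ℕ) (F : (Fin D → ℤ) → ZMod 2) :
    Df M n F = ∑ y ∈ P M n, bd F y + ∑ y ∈ B M n, F y := rfl

lemma Df_bd_zero (M : ℕ) (F : (Fin D → ℤ) → ZMod 2) : Df M 0 (bd F) = 0 := by
  rw [Df_apply, bd_bd]
  simp only [Pi.zero_apply, sum_const_zero, zero_add]
  refine Finset.sum_eq_zero fun y hy => ?_
  rw [bd_apply]
  refine Finset.sum_eq_zero fun c _ => ?_
  simp only [B, Fintype.mem_piFinset] at hy
  have := hy c
  simp only [tB, Nat.not_lt_zero, if_false, mem_singleton] at this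
  simp [this]

lemma Df_bd_succ (M n : ℕ) (hn : n < D) (F : (Fin D → ℤ) → ZMod 2) :
    Df M (n+1) (bd F) = Df M n F + Df M n (fun y => F (-y)) := by
  rw [Df_apply, bd_bd, Df_apply, Df_apply, sum_B_neg, sum_B_succ M n hn, Finset.sum_add_distrib]
  simp only [Pi.zero_apply, sum_const_zero, zero_add, bd_neg]
  have := CharTwo.add_self_eq_zero (∑ y ∈ (B M n : Finset (Fin D → ℤ)), F y)
  linear_combination -this

lemma Df_one (M : ℕ) : Df M 0 (fun _ : Fin D → ℤ => 1) = 1 := by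
  have h : bd (fun _ : Fin D → ℤ => (1 : ZMod 2)) = 0 := by
    ext y
    rw [bd_apply]
    refine Finset.sum_eq_zero fun c _ => ?_
    simp [CharTwo.add_self_eq_zero]
  rw [Df_apply, h]
  have : (B M 0 : Finset (Fin D → ℤ)) = {0} := by
    ext y
    simp [B, tB, Fintype.mem_piFinset, funext_iff]
  rw [this]; simp

/-- boundary of the cube of half-side `2 * M` -/
def X (M : ℕ) (y : Fin D → ℤ) : Prop := (∀ j, |y j| ≤ 2 * M) ∧ ∃ j, |y j| = 2 * M

lemma Df_support (M n : ℕ) (hn : n < D) (F : (Fin D → ℤ) → ZMod 2)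
    (hF : ∀ y, X M y → F y = 0) : Df M n F = 0 := by
  have hstep : ∀ (c : Fin D) (y : Fin D → ℤ) (e : ℤ),
      y + Pi.single c e = update y c (y c + e) := by
    intro c y e
    ext j
    by_cases hj : j = c
    · subst hj; simp
    · simp [hj]
  have habs : ∀ (c : Fin D) (y : Fin D → ℤ), y ∈ P M n → ∀ j, |y j| ≤ 2 * M := by
    intro c y hy j
    simp only [P, Fintype.mem_piFinset] at hy
    have := hy j
    rw [abs_le]
    unfold tP at this
    split_ifs at this
    · simp only [oddI, mem_filter, mem_Icc] at this; omega
    · simp only [oddP, mem_filter, mem_Icc] at this; omega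
    · simp at this; omega
  have hcoord : ∀ c : Fin D, (∑ y ∈ P M n, if Odd (y c) then
      F (y + Pi.single c 1) + F (y + Pi.single c (-1)) else 0) =
      if c.val = n then ∑ y ∈ B M n, F y else 0 := by
    intro c
    simp only [hstep]
    rw [P, sum_split (tP M n) c 0]
    simp only [update_self, update_idem]
    have hz : ∀ z ∈ Fintype.piFinset (update (tP M n) c {0}), ∀ v : ℤ, |v| = 2 * M →
        F (update z c v) = 0 := by
      intro z hz v hv
      apply hF
      refine ⟨fun j => ?_, c, by simpa using hv⟩
      by_cases hj : j = c
      · subst hj; simp [hv]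
      · rw [Fintype.mem_piFinset] at hz
        have := hz j
        simp only [update_of_ne hj] at this ⊢
        rw [abs_le]
        unfold tP at this
        split_ifs at this
        · simp only [oddI, mem_filter, mem_Icc] at this; omega
        · simp only [oddP, mem_filter, mem_Icc] at this; omega
        · simp at this; omega
    have hM : |(2 * (M:ℤ))| = 2 * M := abs_of_nonneg (by positivity)
    by_cases h1 : c.val < n
    · rw [if_neg (by omega)]
      refine Finset.sum_eq_zero fun z hzz => ?_
      have e := telescope (-(2 * (M:ℤ))) ⟨-M, by ring⟩ (2 * M) (fun a => F (update z c a))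
      have e2 : -(2 * (M:ℤ)) + 2 * ((2 * M : ℕ) : ℤ) = 2 * M := by push_cast; ring
      rw [e2] at e
      rw [hz z hzz (2*M) hM, hz z hzz (-(2*M)) (by rw [abs_neg, hM]), add_zero] at e
      rw [← e]
      refine Finset.sum_congr ?_ ?_
      · simp [tP, h1, oddI]
      · intro a ha
        rw [if_pos (mem_filter.mp ha).2, sub_eq_add_neg]
    · by_cases h2 : c.val = n
      · rw [if_pos h2]
        have hB : Fintype.piFinset (update (tP M n) c {0}) = B M n := by
          unfold B
          congr 1
          ext j : 1
          by_cases hj : j = c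
          · subst hj; simp [tB, h2]
          · have : j.val ≠ n := fun h => hj (Fin.ext (h.trans h2.symm))
            simp [update_of_ne hj, tB, tP, this]
        rw [← hB]
        refine Finset.sum_congr rfl fun z hzz => ?_
        have e := telescope 0 ⟨0, by ring⟩ M (fun a => F (update z c a))
        rw [zero_add, hz z hzz (2*M) hM, zero_add] at e
        have hz0 : update z c 0 = z := by
          rw [Fintype.mem_piFinset] at hzz
          have := hzz c
          simp at this
          rw [← this]; simp
        rw [hz0] at e
        rw [← e]
        refine Finset.sum_congr ?_ ?_
        · simp [tP, h2, oddP]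
        · intro a ha
          rw [if_pos (mem_filter.mp ha).2, sub_eq_add_neg]
      · rw [if_neg h2]
        refine Finset.sum_eq_zero fun z hzz => ?_
        have : tP M n c = {0} := by simp [tP, h1, h2]
        rw [this]
        simp
  rw [Df_apply]
  simp only [bd_apply]
  rw [Finset.sum_comm]
  simp only [hcoord]
  rw [Finset.sum_eq_single (⟨n, hn⟩ : Fin D)]
  · simp [CharTwo.add_self_eq_zero]
  · intro b _ hb
    rw [if_neg fun h => hb (Fin.ext h)]
  · simp

/-- a finite box containing all cells -/
def Box (M : ℕ) : Finset (Fin D → ℤ) := Fintype.piFinset (fun _ => Icc (-(2 * (M:ℤ))) (2 * M))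

lemma X_Box {M : ℕ} {y : Fin D → ℤ} (h : X M y) : y ∈ Box M := by
  simp only [Box, Fintype.mem_piFinset, mem_Icc]
  exact fun j => abs_le.mp (h.1 j)

def w (M n : ℕ) (y : Fin D → ℤ) : ZMod 2 := Df M n (Pi.single y 1)

lemma w_support (M n : ℕ) (hn : n < D) (y : Fin D → ℤ) (hy : ¬ X M y) : w M n y = 0 := by
  apply Df_support M n hn
  intro y' hy'
  have : y' ≠ y := fun h => hy (h ▸ hy')
  simp [this]

lemma Df_eq_sum (M n : ℕ) (hn : n < D) (F : (Fin D → ℤ) → ZMod 2) :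
    Df M n F = ∑ y ∈ Box M, w M n y * F y := by
  have : Df M n (F - ∑ y ∈ Box M, F y • Pi.single y 1) = 0 := by
    apply Df_support M n hn
    intro y hy
    simp only [Pi.sub_apply, Finset.sum_apply, Pi.smul_apply, smul_eq_mul]
    rw [Finset.sum_eq_single y]
    · simp
    · intro b _ hb; simp [Ne.symm hb]
    · intro h; exact absurd (X_Box hy) h
  rw [map_sub, sub_eq_zero, map_sum] at this
  rw [this]
  refine Finset.sum_congr rfl fun y _ => ?_
  rw [map_smul, smul_eq_mul, mul_comm]; rfl

end BU


namespace BU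
open Finset Function
variable {D k : ℕ}

def mBox (M : ℕ) (_ : Fin k) : Finset (Fin D → ℤ) := Box M

/-- evaluation on the product chain -/
def W (M : ℕ) (n : Fin k → ℕ) (F : (Fin k → Fin D → ℤ) → ZMod 2) : ZMod 2 :=
  ∑ z ∈ Fintype.piFinset (mBox M), (∏ i, w M (n i) (z i)) * F z

lemma prod_update (M : ℕ) (n : Fin k → ℕ) (z : Fin k → Fin D → ℤ) (i : Fin k) (y : Fin D → ℤ) :
    ∏ j, w M (n j) (update z i y j) = (∏ j ∈ univ.erase i, w M (n j) (z j)) * w M (n i) y := by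
  rw [← Finset.prod_erase_mul univ (fun j => w M (n j) (update z i y j)) (mem_univ i)]
  refine congrArg₂ (· * ·) ?_ ?_
  · refine Finset.prod_congr rfl fun j hj => ?_
    rw [update_of_ne (Finset.ne_of_mem_erase hj)]
  · simp

lemma W_split (M : ℕ) (n : Fin k → ℕ) (i : Fin k) (hn : n i < D)
    (F : (Fin k → Fin D → ℤ) → ZMod 2) :
    W M n F = ∑ z ∈ Fintype.piFinset (update (mBox M) i {0}),
      (∏ j ∈ univ.erase i, w M (n j) (z j)) * Df M (n i) (fun y => F (update z i y)) := by
  rw [W, sum_split _ i 0]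
  refine Finset.sum_congr rfl fun z _ => ?_
  rw [Df_eq_sum M (n i) hn, Finset.mul_sum]
  refine Finset.sum_congr rfl fun y _ => ?_
  rw [prod_update, mul_assoc]

def flip (i : Fin k) (z : Fin k → Fin D → ℤ) : Fin k → Fin D → ℤ := update z i (-(z i))

lemma W_Bd (M : ℕ) (n : Fin k → ℕ) (hn : ∀ i, n i < D) (F : (Fin k → Fin D → ℤ) → ZMod 2) :
    W M n (Bd F) = ∑ i, if n i = 0 then 0 else
      W M (update n i (n i - 1)) (fun z => F z + F (flip i z)) := by
  have h1 : W M n (Bd F) = ∑ i, W M n (fun z => bd (fun y => F (update z i y)) (z i)) := by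
    simp only [W]
    rw [Finset.sum_comm]
    refine Finset.sum_congr rfl fun z _ => ?_
    rw [Bd_eq, Finset.mul_sum]
  rw [h1]
  refine Finset.sum_congr rfl fun i _ => ?_
  rw [W_split M n i (hn i)]
  simp only [update_idem, update_self]
  have e : ∀ z : Fin k → Fin D → ℤ, (fun y => (bd fun y => F (update z i y)) y) =
    bd fun y => F (update z i y) := fun z => rfl
  simp only [e]
  split_ifs with h0
  · rw [h0]
    simp [Df_bd_zero]
  · obtain ⟨n', hn'⟩ := Nat.exists_eq_succ_of_ne_zero h0
    have hlt : n' < D := by have := hn i; omega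
    rw [W_split M _ i (by simp; have := hn i; omega)]
    refine Finset.sum_congr rfl fun z _ => ?_
    congr 1
    · refine Finset.prod_congr rfl fun j hj => ?_
      rw [update_of_ne (Finset.ne_of_mem_erase hj)]
    · rw [hn', Nat.succ_eq_add_one, Df_bd_succ M n' hlt, ← map_add]
      simp only [update_self, flip, update_idem, Nat.add_sub_cancel]
      rfl

lemma W_support (M : ℕ) (n : Fin k → ℕ) (hn : ∀ i, n i < D) (F : (Fin k → Fin D → ℤ) → ZMod 2)
    (h : W M n F ≠ 0) : ∃ z, (∀ i, X M (z i)) ∧ F z ≠ 0 := by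
  obtain ⟨z, _, hz⟩ := Finset.exists_ne_zero_of_sum_ne_zero h
  refine ⟨z, fun i => ?_, right_ne_zero_of_mul hz⟩
  by_contra hX
  exact (Finset.prod_ne_zero_iff.mp (left_ne_zero_of_mul hz) i (mem_univ i))
    (w_support M (n i) (hn i) _ hX)

lemma W_congr (M : ℕ) (n : Fin k → ℕ) (hn : ∀ i, n i < D) (F G : (Fin k → Fin D → ℤ) → ZMod 2)
    (h : ∀ z, (∀ i, X M (z i)) → F z = G z) : W M n F = W M n G := by
  refine Finset.sum_congr rfl fun z _ => ?_
  by_cases hz : ∀ i, X M (z i)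
  · rw [h z hz]
  · push Not at hz
    obtain ⟨i, hi⟩ := hz
    rw [Finset.prod_eq_zero (mem_univ i) (w_support M (n i) (hn i) _ hi), zero_mul, zero_mul]

lemma W_smul (M : ℕ) (n : Fin k → ℕ) (r : ZMod 2) (F : (Fin k → Fin D → ℤ) → ZMod 2) :
    W M n (fun z => r * F z) = r * W M n F := by
  rw [W, W, Finset.mul_sum]
  refine Finset.sum_congr rfl fun z _ => ?_
  ring

lemma W_one (M : ℕ) (hD : 0 < D) : W M (0 : Fin k → ℕ) (fun _ : Fin k → Fin D → ℤ => 1) = 1 := by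
  simp only [W, mul_one, Pi.zero_apply]
  have : ∏ i : Fin k, ∑ y ∈ mBox (D := D) M i, w M 0 y = 1 := by
    refine Finset.prod_eq_one fun i _ => ?_
    have := Df_eq_sum M 0 hD (fun _ => 1)
    rw [Df_one] at this
    rw [this]
    simp [mBox]
  rw [← this, Finset.prod_univ_sum]

/-- iterated cup product of the sign cocycles -/
def T {J : Type*} (s : J → (Fin k → Fin D → ℤ) → ZMod 2) : List J → (Fin k → Fin D → ℤ) → ZMod 2
  | [] => fun _ => 1
  | j :: l => Bd (fun z => s j z * T s l z)

lemma Bd_T {J : Type*} (s : J → (Fin k → Fin D → ℤ) → ZMod 2) (l : List J)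
    (z : Fin k → Fin D → ℤ) : Bd (T s l) z = 0 := by
  cases l with
  | nil =>
    rw [Bd]
    refine Finset.sum_eq_zero fun p _ => ?_
    simp [T, CharTwo.add_self_eq_zero]
  | cons j l => rw [T, Bd_Bd]

/-- going down preserves the cube boundary -/
lemma X_down {M : ℕ} {z : Fin k → Fin D → ℤ} (hz : ∀ i, X M (z i)) (p : Fin k × Fin D)
    (hp : Odd (z p.1 p.2)) (e : ℤ) (he : |e| ≤ 1) : ∀ i, X M ((z + sh p e) i) := by
  have hlt : |z p.1 p.2| + 1 ≤ 2 * M := by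
    have h1 := (hz p.1).1 p.2
    have h2 : |z p.1 p.2| ≠ 2 * M := by
      intro h
      have : Odd |z p.1 p.2| := odd_abs.mpr hp
      rw [h, Int.odd_iff] at this
      omega
    omega
  intro i
  constructor
  · intro c
    by_cases h : p = (i, c)
    · subst h
      have := sh_self (i, c) e
      simp only [Pi.add_apply] at this ⊢
      rw [this]
      exact (abs_add_le _ _).trans (by simp only at hlt; omega)
    · have := sh_ne p (i, c) h e
      simp only [Pi.add_apply] at this ⊢
      rw [this, add_zero]
      exact (hz i).1 c
  · obtain ⟨c, hc⟩ := (hz i).2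
    refine ⟨c, ?_⟩
    have h : p ≠ (i, c) := by
      rintro rfl
      simp only at hlt
      omega
    have := sh_ne p (i, c) h e
    simp only [Pi.add_apply] at this ⊢
    rw [this, add_zero, hc]

lemma X_flip {M : ℕ} {z : Fin k → Fin D → ℤ} (hz : ∀ i, X M (z i)) (i : Fin k) :
    ∀ j, X M (flip i z j) := by
  intro j
  by_cases h : j = i
  · subst h
    simpa [flip, X] using hz j
  · simpa [flip, h] using hz j

lemma Bd_flip (F : (Fin k → Fin D → ℤ) → ZMod 2) (i : Fin k) (z : Fin k → Fin D → ℤ) :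
    Bd F (flip i z) = Bd (fun z => F (flip i z)) z := by
  rw [Bd_eq, Bd_eq]
  refine Finset.sum_congr rfl fun j _ => ?_
  by_cases h : j = i
  · subst h
    simp only [flip, update_self, update_idem]
    rw [bd_neg]
  · simp only [flip, update_of_ne h, update_of_ne (Ne.symm h)]
    simp only [update_comm h]

lemma Bd_congr {M : ℕ} {z : Fin k → Fin D → ℤ} (hz : ∀ i, X M (z i))
    (F G : (Fin k → Fin D → ℤ) → ZMod 2)
    (h : ∀ z, (∀ i, X M (z i)) → F z = G z) : Bd F z = Bd G z := by
  refine Finset.sum_congr rfl fun p _ => ?_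
  split_ifs with hp
  · rw [h _ (X_down hz p hp 1 (by simp)), h _ (X_down hz p hp (-1) (by simp))]
  · rfl

lemma Bd_add (F G : (Fin k → Fin D → ℤ) → ZMod 2) (z : Fin k → Fin D → ℤ) :
    Bd (fun z => F z + G z) z = Bd F z + Bd G z := by
  simp only [Bd, ← Finset.sum_add_distrib]
  refine Finset.sum_congr rfl fun p _ => ?_
  split_ifs
  · ring
  · simp

lemma Bd_smul (r : ZMod 2) (F : (Fin k → Fin D → ℤ) → ZMod 2) (z : Fin k → Fin D → ℤ) :
    Bd (fun z => r * F z) z = r * Bd F z := by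
  simp only [Bd, Finset.mul_sum]
  refine Finset.sum_congr rfl fun p _ => ?_
  split_ifs
  · ring
  · simp

lemma T_flip {J : Type*} {M : ℕ} (s : J → (Fin k → Fin D → ℤ) → ZMod 2) (α : J → Fin k → ZMod 2)
    (hs : ∀ j i z, (∀ i, X M (z i)) → s j (flip i z) = s j z + α j i) (l : List J) (i : Fin k) :
    ∀ z : Fin k → Fin D → ℤ, (∀ i, X M (z i)) → T s l (flip i z) = T s l z := by
  induction l with
  | nil => intro z _; rfl
  | cons j l ih =>
    intro z hz
    rw [T, Bd_flip, Bd_congr hz _ (fun z => s j z * T s l z + α j i * T s l z), Bd_add, Bd_smul,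
      Bd_T, mul_zero, add_zero]
    intro z hz
    rw [hs j i z hz, ih z hz]
    ring

open MvPolynomial in
lemma W_T {J : Type*} {M : ℕ} (hD : 0 < D) (s : J → (Fin k → Fin D → ℤ) → ZMod 2)
    (α : J → Fin k → ZMod 2)
    (hs : ∀ j i z, (∀ i, X M (z i)) → s j (flip i z) = s j z + α j i) (l : List J) :
    ∀ n : Fin k → ℕ, (∀ i, n i < D) → ∑ i, n i = l.length →
    W M n (T s l) = coeff (Finsupp.equivFunOnFinite.symm n)
      (l.map (fun j => ∑ i, C (α j i) * MvPolynomial.X i)).prod := by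
  induction l with
  | nil =>
    intro n hn hsum
    simp only [List.length_nil, Finset.sum_eq_zero_iff, mem_univ, true_implies] at hsum
    have : n = 0 := funext hsum
    subst this
    have e : (Finsupp.equivFunOnFinite.symm (0 : Fin k → ℕ)) = 0 := by ext; simp
    rw [e]
    simp only [List.map_nil, List.prod_nil, coeff_zero_one]
    exact W_one M hD
  | cons j l ih =>
    intro n hn hsum
    rw [T, W_Bd M n hn, List.map_cons, List.prod_cons, Finset.sum_mul, coeff_sum]
    refine Finset.sum_congr rfl fun i _ => ?_
    rw [mul_assoc, coeff_C_mul, coeff_X_mul']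
    split_ifs with h1 h2 h2
    · simp [h1] at h2
    · simp
    · have hn' : ∀ i', update n i (n i - 1) i' < D := by
        intro i'
        by_cases h : i' = i
        · subst h; simp; have := hn i'; omega
        · simpa [h] using hn i'
      rw [W_congr M _ hn' _ (fun z => α j i * T s l z), W_smul, ih _ hn']
      · congr 2
        ext i'
        by_cases h : i' = i
        · subst h; simp
        · simp [h]
      · rw [Finset.sum_update_of_mem (mem_univ i)]
        rw [← Finset.add_sum_erase _ _ (mem_univ i)] at hsum
        rw [List.length_cons] at hsum
        rw [Finset.sdiff_singleton_eq_erase]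
        omega
      · intro z hz
        rw [T_flip s α hs l i z hz, hs j i z hz]
        have := CharTwo.add_self_eq_zero (s j z * T s l z)
        linear_combination this
    · simp [h1] at h2

lemma T_path {J : Type*} {M : ℕ} (s : J → (Fin k → Fin D → ℤ) → ZMod 2) (l : List J) :
    ∀ z : Fin k → Fin D → ℤ, (∀ i, X M (z i)) → T s l z ≠ 0 → ∀ j ∈ l,
    ∃ u v : Fin k → Fin D → ℤ, (∀ i, X M (u i)) ∧ (∀ i, X M (v i)) ∧
      (∀ i c, |u i c - z i c| ≤ l.length) ∧ (∀ i c, |v i c - z i c| ≤ l.length) ∧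
      s j u ≠ s j v := by
  induction l with
  | nil => intro z _ _ j hj; simp at hj
  | cons j l ih =>
    intro z hz hT j' hj'
    have h1 : T s (j :: l) z = Bd (fun z' => (s j z + s j z') * T s l z') z := by
      have : (fun z' => (s j z + s j z') * T s l z') =
        fun z' => s j z * T s l z' + s j z' * T s l z' := by ext; ring
      rw [this, Bd_add, Bd_smul, Bd_T, mul_zero, zero_add, T]
    rw [h1] at hT
    have hex : ∃ p : Fin k × Fin D, ∃ e : ℤ, |e| ≤ 1 ∧ Odd (z p.1 p.2) ∧
        (s j z + s j (z + sh p e)) * T s l (z + sh p e) ≠ 0 := by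
      obtain ⟨p, _, hp⟩ := Finset.exists_ne_zero_of_sum_ne_zero hT
      have hodd : Odd (z p.1 p.2) := by
        by_contra h
        rw [if_neg h] at hp
        exact hp rfl
      rw [if_pos hodd] at hp
      beta_reduce at hp
      by_cases h : (s j z + s j (z + sh p 1)) * T s l (z + sh p 1) = 0
      · rw [h, zero_add] at hp
        exact ⟨p, -1, by simp, hodd, hp⟩
      · exact ⟨p, 1, by simp, hodd, h⟩
    obtain ⟨p, e, he, hodd, hne⟩ := hex
    have hX := X_down hz p hodd e he
    have hd : ∀ i c, |(z + sh p e) i c - z i c| ≤ 1 := by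
      intro i c
      simp only [Pi.add_apply, add_sub_cancel_left]
      by_cases h : p = (i, c)
      · subst h
        have := sh_self (i, c) e
        simp only at this
        rw [this]; exact he
      · have := sh_ne p (i, c) h e
        simp only at this
        rw [this]; simp
    have hl : ((j :: l).length : ℤ) = l.length + 1 := by simp
    rw [hl]
    rcases List.mem_cons.mp hj' with rfl | hmem
    · refine ⟨z, z + sh p e, hz, hX, ?_, ?_, ?_⟩
      · intro i c; simp; positivity
      · intro i c; have := hd i c; omega
      · intro h
        rw [← h, CharTwo.add_self_eq_zero, zero_mul] at hne
        exact hne rfl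
    · obtain ⟨u, v, hu, hv, du, dv, hs⟩ := ih (z + sh p e) hX (right_ne_zero_of_mul hne) j' hmem
      refine ⟨u, v, hu, hv, ?_, ?_, hs⟩
      · intro i c
        have a1 := du i c
        have a2 := hd i c
        have := abs_sub_le (u i c) ((z + sh p e) i c) (z i c)
        omega
      · intro i c
        have a1 := dv i c
        have a2 := hd i c
        have := abs_sub_le (v i c) ((z + sh p e) i c) (z i c)
        omega

end BU


namespace BU
open Finset Function
variable {D k : ℕ}

open Classical in
/-- lexicographic sign -/
def lexs (y : Fin D → ℤ) : ZMod 2 := if ∃ c, y c < 0 ∧ ∀ c' < c, y c' = 0 then 1 else 0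

lemma lexs_neg (y : Fin D → ℤ) (hy : y ≠ 0) : lexs (-y) = lexs y + 1 := by
  have hex : ∃ c, y c ≠ 0 := by
    by_contra h
    push Not at h
    exact hy (funext h)
  obtain ⟨c, hc, hmin⟩ : ∃ c, y c ≠ 0 ∧ ∀ c' < c, y c' = 0 := by
    have hne : (univ.filter (fun c => y c ≠ 0)).Nonempty := by
      obtain ⟨c, hc⟩ := hex
      exact ⟨c, by simpa using hc⟩
    refine ⟨(univ.filter (fun c => y c ≠ 0)).min' hne, ?_, ?_⟩
    · have := Finset.min'_mem _ hne
      simpa using this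
    · intro c' hc'
      by_contra h
      have := Finset.min'_le (univ.filter (fun c => y c ≠ 0)) c' (by simpa using h)
      exact absurd hc' (not_lt.mpr this)
  have key : ∀ y : Fin D → ℤ, y c ≠ 0 → (∀ c' < c, y c' = 0) →
      ((∃ c, y c < 0 ∧ ∀ c' < c, y c' = 0) ↔ y c < 0) := by
    intro y hc hmin
    constructor
    · rintro ⟨c2, h1, h2⟩
      rcases lt_trichotomy c c2 with h | h | h
      · exact absurd (h2 c h) hc
      · subst h; exact h1
      · have := hmin c2 h; omega
    · intro h; exact ⟨c, h, hmin⟩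
  have k1 := key y hc hmin
  have k2 := key (-y) (by simpa using hc) (by simpa using hmin)
  unfold lexs
  rw [if_congr k1 rfl rfl, if_congr k2 rfl rfl]
  simp only [Pi.neg_apply]
  rcases lt_or_gt_of_ne hc with h | h
  · rw [if_neg (by omega), if_pos h]; rfl
  · rw [if_pos (by omega), if_neg (by omega)]; rfl

def sc (M : ℕ) (z : Fin k → Fin D → ℤ) : Fin k → Fin D → ℝ := fun i c => (z i c : ℝ) / (2 * M)

def K (k D : ℕ) : Set (Fin k → Fin D → ℝ) := {p | ∀ i, ‖p i‖ = 1}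

lemma sc_mem {M : ℕ} (hM : 0 < M) {z : Fin k → Fin D → ℤ} (hz : ∀ i, X M (z i)) :
    sc M z ∈ K k D := by
  intro i
  have hM' : (0:ℝ) < 2 * M := by positivity
  have hc : ∀ c, ‖sc M z i c‖ = |z i c| / (2 * M) := by
    intro c
    rw [sc, Real.norm_eq_abs, abs_div, abs_of_pos hM', Int.cast_abs]
  apply le_antisymm
  · rw [pi_norm_le_iff_of_nonneg zero_le_one]
    intro c
    rw [hc, div_le_one hM']
    exact_mod_cast (hz i).1 c
  · obtain ⟨c, h⟩ := (hz i).2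
    have := norm_le_pi_norm (sc M z i) c
    rw [hc, h] at this
    push_cast at this
    rwa [div_self hM'.ne'] at this

lemma sc_flip (M : ℕ) (z : Fin k → Fin D → ℤ) (i : Fin k) :
    sc M (flip i z) = update (sc M z) i (-(sc M z i)) := by
  ext j c
  by_cases h : j = i
  · subst h; simp [sc, flip, neg_div]
  · simp [sc, flip, h]

lemma isCompact_K : IsCompact (K k D) := by
  apply Metric.isCompact_of_isClosed_isBounded
  · have : K k D = ⋂ i, {p | ‖p i‖ = 1} := by ext; simp [K]
    rw [this]
    exact isClosed_iInter fun i => isClosed_eq (by fun_prop) continuous_const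
  · refine (Metric.isBounded_closedBall (x := (0 : Fin k → Fin D → ℝ)) (r := 1)).subset ?_
    intro p hp
    rw [mem_closedBall_zero_iff, pi_norm_le_iff_of_nonneg zero_le_one]
    exact fun i => (hp i).le

open MvPolynomial in
/-- Borsuk-Ulam type theorem for products of spheres. -/
theorem borsuk_ulam {J : Type*} [Fintype J] (hD : 0 < D) (n : Fin k → ℕ) (hn : ∀ i, n i < D)
    (hsum : ∑ i, n i = Fintype.card J)
    (f : J → (Fin k → Fin D → ℝ) → ℝ) (α : J → Fin k → ZMod 2)
    (hcont : ∀ j, ContinuousOn (f j) (K k D))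
    (hodd : ∀ j i p, p ∈ K k D → f j (update p i (-(p i))) =
      if α j i = 0 then f j p else - f j p)
    (hcoef : coeff (Finsupp.equivFunOnFinite.symm n)
      (∏ j, ∑ i, C (α j i) * MvPolynomial.X i) ≠ 0) :
    ∃ p ∈ K k D, ∀ j, f j p = 0 := by
  by_contra hcon
  push Not at hcon
  set L := Fintype.card J with hL
  have main : ∀ M : ℕ, 0 < M → ∃ z : Fin k → Fin D → ℤ, (∀ i, X M (z i)) ∧ ∀ j,
      ∃ u v : Fin k → Fin D → ℤ, (∀ i, X M (u i)) ∧ (∀ i, X M (v i)) ∧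
      (∀ i c, |u i c - z i c| ≤ L) ∧ (∀ i c, |v i c - z i c| ≤ L) ∧
      f j (sc M u) ≤ 0 ∧ 0 ≤ f j (sc M v) := by
    intro M hM
    let s : J → (Fin k → Fin D → ℤ) → ZMod 2 := fun j z =>
      if f j (sc M z) < 0 then 1 else if 0 < f j (sc M z) then 0 else ∑ i, α j i * lexs (z i)
    have hs : ∀ j i z, (∀ i, X M (z i)) → s j (flip i z) = s j z + α j i := by
      intro j i z hz
      have e := hodd j i (sc M z) (sc_mem hM hz)
      rw [← sc_flip] at e
      have hzi : z i ≠ 0 := by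
        intro h
        obtain ⟨c, hc⟩ := (hz i).2
        rw [h] at hc
        simp at hc
        omega
      have hsumflip : ∑ i', α j i' * lexs (flip i z i') = ∑ i', α j i' * lexs (z i') + α j i := by
        rw [← Finset.add_sum_erase _ _ (mem_univ i),
          ← Finset.add_sum_erase univ (fun i' => α j i' * lexs (z i')) (mem_univ i)]
        have : ∑ x ∈ univ.erase i, α j x * lexs (flip i z x) =
            ∑ x ∈ univ.erase i, α j x * lexs (z x) := by
          refine Finset.sum_congr rfl fun x hx => ?_
          rw [flip, update_of_ne (Finset.ne_of_mem_erase hx)]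
        rw [this, flip, update_self, lexs_neg _ hzi]
        ring
      simp only [s]
      rw [hsumflip, e]
      have h01 : ∀ a : ZMod 2, a = 0 ∨ a = 1 := by decide
      rcases h01 (α j i) with h | h
      · rw [h]; simp
      · rw [h, if_neg one_ne_zero]
        rcases lt_trichotomy (f j (sc M z)) 0 with h' | h' | h'
        · rw [if_neg (by linarith), if_pos (by linarith), if_pos h']; rfl
        · rw [h']; simp
        · rw [if_pos (by linarith), if_neg (by linarith), if_pos h']; rfl
    have hW := W_T hD s α hs (univ : Finset J).toList n hn (by rw [hsum]; simp [hL])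
    have hprod : ((univ : Finset J).toList.map (fun j => ∑ i, C (α j i) * MvPolynomial.X i)).prod =
        ∏ j, ∑ i, C (α j i) * (MvPolynomial.X i : MvPolynomial (Fin k) (ZMod 2)) :=
      Finset.prod_map_toList _ _
    rw [hprod] at hW
    rw [← hW] at hcoef
    obtain ⟨z, hz, hTz⟩ := W_support M n hn _ hcoef
    refine ⟨z, hz, fun j => ?_⟩
    obtain ⟨u, v, hu, hv, du, dv, hne⟩ := T_path s _ z hz hTz j (by simp)
    have hlen : ((univ : Finset J).toList.length : ℤ) = L := by simp [hL]
    rw [hlen] at du dv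
    have hor : (f j (sc M u) ≤ 0 ∧ 0 ≤ f j (sc M v)) ∨ (f j (sc M v) ≤ 0 ∧ 0 ≤ f j (sc M u)) := by
      by_contra hh
      push Not at hh
      apply hne
      simp only [s]
      rcases lt_trichotomy (f j (sc M u)) 0 with h' | h' | h'
      · have := hh.1 h'.le
        rw [if_pos h', if_pos this]
      · have h1 := hh.1 h'.le
        have h2 := hh.2 h1.le
        linarith
      · have h3 : 0 < f j (sc M v) := by
          by_contra h4
          have := hh.2 (not_lt.mp h4)
          linarith
        rw [if_neg h'.not_gt, if_neg h3.not_gt, if_pos h', if_pos h3]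
    rcases hor with h | h
    · exact ⟨u, v, hu, hv, du, dv, h.1, h.2⟩
    · exact ⟨v, u, hv, hu, dv, du, h.1, h.2⟩
  have hne : (K k D).Nonempty := by
    obtain ⟨z, hz, _⟩ := main 1 one_pos
    exact ⟨_, sc_mem one_pos hz⟩
  have hG : ContinuousOn (fun p => ∑ j, |f j p|) (K k D) :=
    continuousOn_finsetSum _ fun j _ => (hcont j).abs
  obtain ⟨p0, hp0, hmin⟩ := isCompact_K.exists_isMinOn hne hG
  have hpos : 0 < ∑ j, |f j p0| := by
    obtain ⟨j, hj⟩ := hcon p0 hp0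
    exact Finset.sum_pos' (fun _ _ => abs_nonneg _) ⟨j, mem_univ j, abs_pos.mpr hj⟩
  set η := ∑ j, |f j p0| with hη
  have hF : ContinuousOn (fun p (j : J) => f j p) (K k D) := continuousOn_pi.mpr hcont
  have hU := isCompact_K.uniformContinuousOn_of_continuous hF
  rw [Metric.uniformContinuousOn_iff] at hU
  have hε : 0 < η / (L + 1) := by positivity
  obtain ⟨δ, hδ, hUδ⟩ := hU (η / (L + 1)) hε
  obtain ⟨M, hMgt⟩ := exists_nat_gt (L / δ + 1)
  have hLd : 0 ≤ L / δ := by positivity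
  have hM : 0 < M := by
    have : (0:ℝ) < M := by linarith
    exact_mod_cast this
  have hM' : (0:ℝ) < 2 * M := by positivity
  obtain ⟨z, hz, hzj⟩ := main M hM
  have hdist : ∀ u : Fin k → Fin D → ℤ, (∀ i c, |u i c - z i c| ≤ L) →
      dist (sc M z) (sc M u) < δ := by
    intro u hu
    rw [dist_comm, dist_pi_lt_iff hδ]
    intro i
    rw [dist_pi_lt_iff hδ]
    intro c
    rw [Real.dist_eq, sc, sc, ← sub_div, abs_div, abs_of_pos hM', div_lt_iff₀ hM']
    have h1 : |(u i c : ℝ) - z i c| ≤ L := by exact_mod_cast hu i c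
    have h2 : (L:ℝ) < δ * M := by
      have : L / δ < M := by linarith
      rwa [div_lt_iff₀ hδ, mul_comm] at this
    nlinarith
  have hsmall : ∀ j, |f j (sc M z)| < η / (L + 1) := by
    intro j
    obtain ⟨u, v, hu, hv, du, dv, h1, h2⟩ := hzj j
    have a1 := hUδ _ (sc_mem hM hz) _ (sc_mem hM hu) (hdist u du)
    have a2 := hUδ _ (sc_mem hM hz) _ (sc_mem hM hv) (hdist v dv)
    have b1 := (dist_pi_lt_iff hε).mp a1 j
    have b2 := (dist_pi_lt_iff hε).mp a2 j
    rw [Real.dist_eq, abs_lt] at b1 b2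
    rw [abs_lt]
    constructor <;> linarith
  have h1 : η ≤ ∑ j, |f j (sc M z)| := hmin (sc_mem hM hz)
  have h2 : ∑ j, |f j (sc M z)| ≤ ∑ _j : J, η / (L + 1) :=
    Finset.sum_le_sum fun j _ => (hsmall j).le
  rw [Finset.sum_const, nsmul_eq_mul, Finset.card_univ, ← hL] at h2
  have h3 : (L:ℝ) * (η / (L + 1)) < η := by
    rw [← mul_div_assoc, div_lt_iff₀ (by positivity)]
    nlinarith
  linarith

end BU


namespace BU
open Finset Function MvPolynomial
variable {k : ℕ}

def ex (σ : Equiv.Perm (Fin k)) : Fin k →₀ ℕ := Finsupp.equivFunOnFinite.symm fun i => (σ i).val + 1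

lemma ex_apply (σ : Equiv.Perm (Fin k)) (i : Fin k) : ex σ i = (σ i).val + 1 := rfl

def R (k : ℕ) : Fin k →₀ ℕ := Finsupp.equivFunOnFinite.symm fun i => k - i.val

lemma R_apply (i : Fin k) : R k i = k - i.val := rfl

lemma ex_rev : ex (Fin.revPerm : Equiv.Perm (Fin k)) = R k := by
  ext i
  simp only [ex_apply, R_apply, Fin.revPerm_apply, Fin.val_rev]
  omega

def V (k : ℕ) : MvPolynomial (Fin k) (ZMod 2) := ∑ σ : Equiv.Perm (Fin k), monomial (ex σ) 1

lemma V_eq : V k = (∏ i, MvPolynomial.X i) * ∏ i : Fin k, ∏ j ∈ Ioi i,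
    (MvPolynomial.X j + MvPolynomial.X i) := by
  have h := Matrix.det_vandermonde (fun i : Fin k => (MvPolynomial.X i : MvPolynomial (Fin k) (ZMod 2)))
  simp only [CharTwo.sub_eq_add] at h
  rw [← h, Matrix.det_apply, Finset.mul_sum, V, ← Equiv.sum_comp (Equiv.inv _)]
  refine Finset.sum_congr rfl fun σ _ => ?_
  have hs : ∀ p : MvPolynomial (Fin k) (ZMod 2), Equiv.Perm.sign σ • p = p := by
    intro p
    rcases Int.units_eq_one_or (Equiv.Perm.sign σ) with h | h <;> rw [h] <;> simp
    exact CharTwo.neg_eq p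
  rw [hs, ← Equiv.prod_comp σ, ← Finset.prod_mul_distrib, monomial_eq, Finsupp.prod_fintype]
  · rw [C_1, one_mul, ← Equiv.prod_comp σ]
    refine Finset.prod_congr rfl fun i _ => ?_
    have hi : (Equiv.inv (Equiv.Perm (Fin k)) σ) (σ i) = i := σ.symm_apply_apply i
    rw [Matrix.vandermonde_apply, ex_apply, hi, pow_succ, mul_comm]
  · simp

lemma ex_injective : Injective (ex : Equiv.Perm (Fin k) → _) := by
  intro σ τ h
  ext i
  have := DFunLike.congr_fun h i
  simp only [ex_apply] at this
  omega

lemma coeff_R : coeff (R k) (V k) = 1 := by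
  rw [V, coeff_sum, Finset.sum_eq_single (Fin.revPerm : Equiv.Perm (Fin k))]
  · rw [ex_rev]; simp
  · intro σ _ h
    rw [coeff_monomial, if_neg]
    rw [← ex_rev]
    exact fun h' => h (ex_injective h')
  · simp

lemma degree_V : MonomialOrder.lex.degree (V k) = R k := by
  apply MonomialOrder.lex.toSyn.injective
  apply le_antisymm
  · rw [MonomialOrder.degree_le_iff]
    intro u hu
    have : ∃ σ, ex σ = u := by
      by_contra hno
      push Not at hno
      rw [mem_support_iff, V, coeff_sum] at hu
      apply hu
      refine Finset.sum_eq_zero fun σ _ => ?_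
      rw [coeff_monomial, if_neg (hno σ)]
    obtain ⟨σ, rfl⟩ := this
    rw [MonomialOrder.lex_le_iff, ← not_lt, Finsupp.Lex.lt_iff]
    rintro ⟨j, h1, h2⟩
    simp only [ofLex_toLex, R_apply, ex_apply] at h1 h2
    have hσ := (σ j).isLt
    let j2 : Fin k := ⟨k - 1 - (σ j).val, by omega⟩
    have hlt : j2 < j := by
      rw [Fin.lt_def]; simp only [j2]; omega
    have := h1 j2 hlt
    have e : σ j2 = σ j := by
      ext
      simp only [j2] at this ⊢
      omega
    exact hlt.ne (σ.injective e)
  · apply MonomialOrder.le_degree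
    rw [mem_support_iff, coeff_R]
    exact one_ne_zero

lemma rename_V (τ : Equiv.Perm (Fin k)) : rename τ (V k) = V k := by
  rw [V, map_sum, ← Equiv.sum_comp (Equiv.mulRight τ)]
  refine Finset.sum_congr rfl fun σ _ => ?_
  rw [rename_monomial]
  have h : Finsupp.mapDomain τ (ex (Equiv.mulRight τ σ)) = ex σ := by
    ext i
    conv_lhs => rw [← τ.apply_symm_apply i]
    rw [Finsupp.mapDomain_apply τ.injective]
    simp [ex_apply]
  rw [h]

lemma coeff_V_pow_sR (s : ℕ) : coeff (s • R k) (V k ^ s) = 1 := by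
  have := MonomialOrder.lex.coeff_pow_nsmul_degree (V k) s
  rw [MonomialOrder.leadingCoeff, degree_V, coeff_R, one_pow] at this
  exact this

/-- the target exponent -/
def tgt (k Q s : ℕ) (i : Fin k) : ℕ := Q * (i.val + 1) + s * (k - i.val)

lemma only_one (Q s : ℕ) (hQ : s < Q) (σ : Equiv.Perm (Fin k))
    (hle : Q • ex σ ≤ Finsupp.equivFunOnFinite.symm (tgt k Q s))
    (hne : coeff (Finsupp.equivFunOnFinite.symm (tgt k Q s) - Q • ex σ) (V k ^ s) ≠ 0) :
    σ = 1 := by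
  set u := Finsupp.equivFunOnFinite.symm (tgt k Q s) - Q • ex σ with hu
  by_contra hσ
  have h1 : coeff (Finsupp.mapDomain σ u) (V k ^ s) ≠ 0 := by
    have e : rename σ (V k ^ s) = V k ^ s := by rw [map_pow, rename_V]
    rw [← e, coeff_rename_mapDomain _ σ.injective]
    exact hne
  have h2 := MonomialOrder.lex.le_degree (mem_support_iff.mpr h1)
  rw [MonomialOrder.degree_pow, degree_V, MonomialOrder.lex_le_iff, ← not_lt] at h2
  apply h2
  rw [Finsupp.Lex.lt_iff]
  have hex : (univ.filter fun j => σ.symm j ≠ j).Nonempty := by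
    by_contra h
    rw [Finset.not_nonempty_iff_eq_empty, Finset.filter_eq_empty_iff] at h
    apply hσ
    ext j
    have := h (mem_univ j)
    push Not at this
    have h3 : σ j = j := by
      conv_lhs => rw [← this]
      simp
    simp [h3]
  set j := (univ.filter fun j => σ.symm j ≠ j).min' hex with hj
  have hj1 : σ.symm j ≠ j := by
    have := Finset.min'_mem _ hex
    simpa using this
  have hj2 : ∀ j' < j, σ.symm j' = j' := by
    intro j' hlt
    by_contra h
    have := Finset.min'_le (univ.filter fun j => σ.symm j ≠ j) j' (by simpa using h)
    exact absurd hlt (not_lt.mpr this)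
  have hval : ∀ j, Finsupp.mapDomain σ u j =
      Q * ((σ.symm j).val + 1) + s * (k - (σ.symm j).val) - Q * (j.val + 1) := by
    intro j
    conv_lhs => rw [← σ.apply_symm_apply j]
    rw [Finsupp.mapDomain_apply σ.injective]
    simp [hu, tgt, ex_apply]
  refine ⟨j, ?_, ?_⟩
  · intro j' hlt
    simp only [ofLex_toLex]
    rw [hval, hj2 j' hlt]
    simp [R_apply]
  · simp only [ofLex_toLex]
    rw [hval]
    have hgt : j < σ.symm j := by
      rcases lt_trichotomy (σ.symm j) j with h | h | h
      · have := hj2 _ h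
        exact absurd (σ.symm.injective this) hj1
      · exact absurd h hj1
      · exact h
    rw [Fin.lt_def] at hgt
    obtain ⟨a, ha⟩ : ∃ a, (σ.symm j).val = j.val + 1 + a := Nat.exists_eq_add_of_le hgt
    have hlt := (σ.symm j).isLt
    obtain ⟨b, hb⟩ : ∃ b, k = (σ.symm j).val + b := Nat.exists_eq_add_of_le hlt.le
    simp only [Finsupp.smul_apply, R_apply, smul_eq_mul]
    have e1 : k - (σ.symm j).val = b := by omega
    have e2 : k - j.val = b + 1 + a := by omega
    rw [e1, e2, ha, Nat.lt_sub_iff_add_lt]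
    nlinarith [Nat.zero_le a]

lemma coeff_target (q s : ℕ) (hs : s < 2 ^ q) :
    coeff (Finsupp.equivFunOnFinite.symm (tgt k (2 ^ q) s)) (V k ^ (2 ^ q + s)) = 1 := by
  have hQ : V k ^ (2 ^ q) = ∑ σ : Equiv.Perm (Fin k), monomial (2 ^ q • ex σ) 1 := by
    rw [V, sum_pow_char_pow 2]
    refine Finset.sum_congr rfl fun σ _ => ?_
    rw [monomial_pow, one_pow]
  rw [pow_add, hQ, Finset.sum_mul, coeff_sum, Finset.sum_eq_single 1]
  · have hle : 2 ^ q • ex (1 : Equiv.Perm (Fin k)) ≤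
        Finsupp.equivFunOnFinite.symm (tgt k (2 ^ q) s) := by
      intro i
      simp [ex_apply, tgt]
    rw [coeff_monomial_mul', if_pos hle, one_mul]
    have : Finsupp.equivFunOnFinite.symm (tgt k (2 ^ q) s) - 2 ^ q • ex (1 : Equiv.Perm (Fin k))
        = s • R k := by
      ext i
      simp [ex_apply, tgt, R_apply]
    rw [this, coeff_V_pow_sR]
  · intro σ _ hσ
    rw [coeff_monomial_mul']
    split_ifs with hle
    · rw [one_mul]
      by_contra hne
      exact hσ (only_one _ s hs σ hle hne)
    · rfl
  · simp

end BU


namespace BU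
open Finset Function MvPolynomial

abbrev Ix (k m : ℕ) : Type := Fin m × (Fin k ⊕ {p : Fin k × Fin k // p.1 < p.2})

def al {k m : ℕ} : Ix k m → Fin k → ZMod 2
  | (_, Sum.inl i) => Pi.single i 1
  | (_, Sum.inr p) => Pi.single p.1.1 1 + Pi.single p.1.2 1

lemma lin_single {k : ℕ} (i : Fin k) :
    ∑ c, C ((Pi.single i 1 : Fin k → ZMod 2) c) * MvPolynomial.X c =
      (MvPolynomial.X i : MvPolynomial (Fin k) (ZMod 2)) := by
  rw [Finset.sum_eq_single i]
  · simp
  · intro j _ h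
    simp [h]
  · simp

lemma prod_al (k m : ℕ) :
    ∏ j : Ix k m, ∑ i, C (al j i) * MvPolynomial.X i = V k ^ m := by
  rw [Fintype.prod_prod_type]
  have : ∀ r : Fin m, ∏ c : Fin k ⊕ {p : Fin k × Fin k // p.1 < p.2},
      ∑ i, C (al (r, c) i) * MvPolynomial.X i = V k := by
    intro r
    rw [Fintype.prod_sum_type, V_eq]
    congr 1
    · exact Finset.prod_congr rfl fun i _ => lin_single i
    · have h1 : ∀ p : {p : Fin k × Fin k // p.1 < p.2},
          ∑ i, C (al (r, Sum.inr p) i) * MvPolynomial.X i =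
            (MvPolynomial.X p.1.2 + MvPolynomial.X p.1.1 : MvPolynomial (Fin k) (ZMod 2)) := by
        intro p
        simp only [al, Pi.add_apply, map_add, add_mul, Finset.sum_add_distrib]
        rw [lin_single, lin_single, add_comm]
      rw [Finset.prod_congr rfl fun p _ => h1 p]
      rw [← Finset.prod_subtype (univ.filter fun p : Fin k × Fin k => p.1 < p.2) (by simp)
        (fun p : Fin k × Fin k =>
          (MvPolynomial.X p.2 + MvPolynomial.X p.1 : MvPolynomial (Fin k) (ZMod 2)))]
      rw [Finset.prod_finset_product _ univ (fun i => Ioi i)]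
      simp
  rw [Finset.prod_congr rfl fun r _ => this r]
  simp

lemma sum_card {k : ℕ} {J : Type*} [Fintype J] (n : Fin k → ℕ) (α : J → Fin k → ZMod 2)
    (h : coeff (Finsupp.equivFunOnFinite.symm n)
      (∏ j, ∑ i, C (α j i) * MvPolynomial.X i) ≠ 0) : ∑ i, n i = Fintype.card J := by
  have hh : (∏ j : J, ∑ i, C (α j i) * MvPolynomial.X i).IsHomogeneous (∑ _j : J, 1) := by
    apply IsHomogeneous.prod
    intro j _
    apply IsHomogeneous.sum
    intro i _
    simpa using (isHomogeneous_C (Fin k) (α j i)).mul (isHomogeneous_X (ZMod 2) i)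
  by_contra hne
  refine h (hh.coeff_eq_zero ?_)
  rw [Finsupp.degree_eq_sum]
  simpa using hne

theorem borsuk_ulam_app (q s k : ℕ) (hk : 0 < k) (hs : s < 2 ^ q)
    (f : Ix k (2 ^ q + s) → (Fin k → Fin (2 ^ q * k + s + 1) → ℝ) → ℝ)
    (hcont : ∀ j, ContinuousOn (f j) (K k _))
    (hodd : ∀ j i p, p ∈ K k _ → f j (update p i (-(p i))) =
      if al j i = 0 then f j p else - f j p) :
    ∃ p ∈ K k (2 ^ q * k + s + 1), ∀ j, f j p = 0 := by
  have hc : coeff (Finsupp.equivFunOnFinite.symm (tgt k (2 ^ q) s))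
      (∏ j : Ix k (2 ^ q + s), ∑ i, C (al j i) * MvPolynomial.X i) ≠ 0 := by
    rw [prod_al, coeff_target q s hs]
    exact one_ne_zero
  refine borsuk_ulam (Nat.succ_pos _) (tgt k (2 ^ q) s) ?_ (sum_card _ _ hc) f al hcont hodd hc
  intro i
  have hi := i.isLt
  obtain ⟨e, he⟩ := Nat.exists_eq_add_of_lt hi
  have h1 : k - i.val = e + 1 := by omega
  rw [tgt, h1]
  generalize 2 ^ q = Q at *
  rw [Nat.lt_succ_iff]
  have h2 : Q * k = Q * (i.val + 1) + Q * e := by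
    rw [← mul_add]
    congr 1
    omega
  have h3 : s * e ≤ Q * e := Nat.mul_le_mul_right e hs.le
  rw [h2, mul_add s]
  omega

end BU


namespace BU
open Finset Function

variable {d : ℕ}

def na (y : Fin (d + 1) → ℝ) : EuclideanSpace ℝ (Fin d) := WithLp.toLp 2 fun c => y c.castSucc

lemma na_neg (y : Fin (d + 1) → ℝ) : na (-y) = - na y := by
  ext c; simp [na]

lemma na_continuous : Continuous (na (d := d)) := by
  unfold na
  fun_prop

def ph (y : Fin (d + 1) → ℝ) (x : EuclideanSpace ℝ (Fin d)) : ℝ := ⟪na y, x⟫ - y (Fin.last d)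

lemma ph_neg (y : Fin (d + 1) → ℝ) (x : EuclideanSpace ℝ (Fin d)) : ph (-y) x = - ph y x := by
  simp only [ph, na_neg, inner_neg_left, Pi.neg_apply]
  ring

lemma ph_continuous_left (x : EuclideanSpace ℝ (Fin d)) : Continuous fun y => ph y x := by
  unfold ph
  exact (na_continuous.inner continuous_const).sub (continuous_apply _)

lemma ph_continuous_right (y : Fin (d + 1) → ℝ) : Continuous (ph y) := by
  unfold ph
  exact (continuous_const.inner continuous_id).sub continuous_const

def sg (x : ℝ) : ℝ := if 0 < x then 1 else if x < 0 then -1 else 0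

lemma sg_neg (x : ℝ) : sg (-x) = - sg x := by
  unfold sg
  rcases lt_trichotomy x 0 with h | h | h
  · simp [h, h.le, not_lt.mpr h.le]
  · simp [h]
  · simp [h, h.le, not_lt.mpr h.le]

lemma sg_measurable : Measurable sg := by
  unfold sg
  exact Measurable.ite measurableSet_Ioi measurable_const
    (Measurable.ite measurableSet_Iio measurable_const measurable_const)

lemma sg_abs (x : ℝ) : |sg x| ≤ 1 := by
  unfold sg
  split_ifs <;> simp

lemma sg_continuousAt {x : ℝ} (h : x ≠ 0) : ContinuousAt sg x := by
  rcases lt_or_gt_of_ne h with h | h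
  · refine (continuousAt_const (y := (-1 : ℝ))).congr ?_
    filter_upwards [isOpen_Iio.mem_nhds h] with y hy
    have hy' : y < 0 := hy
    simp [sg, hy', not_lt.mpr hy'.le]
  · refine (continuousAt_const (y := (1 : ℝ))).congr ?_
    filter_upwards [isOpen_Ioi.mem_nhds h] with y hy
    have hy' : 0 < y := hy
    simp [sg, hy']

lemma last_ne {y : Fin (d + 1) → ℝ} (hy : y ≠ 0) (h : na y = 0) : y (Fin.last d) ≠ 0 := by
  intro h0
  apply hy
  funext c
  refine Fin.lastCases h0 (fun c => ?_) c
  have := congrArg (fun v : EuclideanSpace ℝ (Fin d) => v c) h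
  simpa [na] using this

lemma null_hyper (μ : Measure (EuclideanSpace ℝ (Fin d))) (hac : μ ≪ volume)
    {y : Fin (d + 1) → ℝ} (hy : y ≠ 0) : ∀ᵐ x ∂μ, ph y x ≠ 0 := by
  by_cases h : na y = 0
  · refine Filter.Eventually.of_forall fun x => ?_
    simpa [ph, h] using last_ne hy h
  · suffices hv : ∀ᵐ x ∂(volume : Measure (EuclideanSpace ℝ (Fin d))), ph y x ≠ 0 from
      hac.ae_le hv
    rw [ae_iff]
    simp only [not_not]
    let A : AffineSubspace ℝ (EuclideanSpace ℝ (Fin d)) :=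
      { carrier := {x | ph y x = 0}
        smul_vsub_vadd_mem' := by
          intro c p1 p2 p3 h1 h2 h3
          simp only [ph, Set.mem_setOf_eq, vsub_eq_sub, vadd_eq_add, inner_add_right,
            real_inner_smul_right, inner_sub_right] at h1 h2 h3 ⊢
          linear_combination c * h1 - c * h2 + h3 }
    refine Measure.addHaar_affineSubspace volume A fun hA => ?_
    have hmem : ∀ x, ph y x = 0 := fun x => by
      have : x ∈ A := by rw [hA]; trivial
      exact this
    have h0 := hmem 0
    have h1 := hmem (na y)
    simp only [ph, inner_zero_right] at h0 h1
    have : ⟪na y, na y⟫ = 0 := by linarith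
    exact h (inner_self_eq_zero.mp this)

section
variable {k : ℕ} {D : ℕ}

lemma K_ne {p : Fin k → Fin D → ℝ} (hp : p ∈ K k D) (i : Fin k) : p i ≠ 0 := by
  intro h
  have := hp i
  rw [h] at this
  simp at this

end

variable {k : ℕ}

lemma sgph_meas (y : Fin (d + 1) → ℝ) : Measurable fun x => sg (ph y x) :=
  sg_measurable.comp (ph_continuous_right y).measurable

lemma cont_one (μ : Measure (EuclideanSpace ℝ (Fin d))) [IsFiniteMeasure μ] (hac : μ ≪ volume)
    (i : Fin k) :
    ContinuousOn (fun p : Fin k → Fin (d + 1) → ℝ => ∫ x, sg (ph (p i) x) ∂μ) (K k (d + 1)) := by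
  intro p hp
  refine continuousWithinAt_of_dominated (bound := fun _ => 1) ?_ ?_ (integrable_const 1) ?_
  · exact Filter.Eventually.of_forall fun p => (sgph_meas (p i)).aestronglyMeasurable
  · exact Filter.Eventually.of_forall fun p => Filter.Eventually.of_forall fun x => sg_abs _
  · filter_upwards [null_hyper μ hac (K_ne hp i)] with x hx
    exact (ContinuousAt.comp (f := fun p : Fin k → Fin (d + 1) → ℝ => ph (p i) x)
      (sg_continuousAt hx)
      ((ph_continuous_left x).comp (continuous_apply i)).continuousAt).continuousWithinAt

lemma sg_abs2 (u v : ℝ) : ‖sg u * sg v‖ ≤ 1 := by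
  rw [norm_mul]
  exact mul_le_one₀ (sg_abs u) (norm_nonneg _) (sg_abs v)

lemma cont_two (μ : Measure (EuclideanSpace ℝ (Fin d))) [IsFiniteMeasure μ] (hac : μ ≪ volume)
    (i j : Fin k) :
    ContinuousOn (fun p : Fin k → Fin (d + 1) → ℝ => ∫ x, sg (ph (p i) x) * sg (ph (p j) x) ∂μ)
      (K k (d + 1)) := by
  intro p hp
  refine continuousWithinAt_of_dominated (bound := fun _ => 1) ?_ ?_ (integrable_const 1) ?_
  · exact Filter.Eventually.of_forall fun p =>
      ((sgph_meas (p i)).mul (sgph_meas (p j))).aestronglyMeasurable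
  · exact Filter.Eventually.of_forall fun p => Filter.Eventually.of_forall fun x => sg_abs2 _ _
  · filter_upwards [null_hyper μ hac (K_ne hp i), null_hyper μ hac (K_ne hp j)] with x hx hx'
    have h1 : ∀ i, ph (p i) x ≠ 0 →
        ContinuousAt (fun p : Fin k → Fin (d + 1) → ℝ => sg (ph (p i) x)) p := fun i hx =>
      (ContinuousAt.comp (f := fun p : Fin k → Fin (d + 1) → ℝ => ph (p i) x)
      (sg_continuousAt hx)
      ((ph_continuous_left x).comp (continuous_apply i)).continuousAt)
    exact ((h1 i hx).mul (h1 j hx')).continuousWithinAt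

/-- the test functions -/
def tf {m : ℕ} (μ : Fin m → Measure (EuclideanSpace ℝ (Fin d))) :
    Ix k m → (Fin k → Fin (d + 1) → ℝ) → ℝ
  | (r, Sum.inl i), p => ∫ x, sg (ph (p i) x) ∂(μ r)
  | (r, Sum.inr c), p => ∫ x, sg (ph (p c.1.1) x) * sg (ph (p c.1.2) x) ∂(μ r)

lemma tf_odd {m : ℕ} (μ : Fin m → Measure (EuclideanSpace ℝ (Fin d))) (j : Ix k m) (i : Fin k)
    (p : Fin k → Fin (d + 1) → ℝ) :
    tf μ j (update p i (-(p i))) = if al j i = 0 then tf μ j p else - tf μ j p := by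
  obtain ⟨r, j | ⟨⟨a, b⟩, hab⟩⟩ := j
  · simp only [tf, al]
    by_cases h : i = j
    · subst h
      simp [ph_neg, sg_neg, integral_neg]
    · simp [h, Ne.symm h, Pi.single_apply]
  · simp only [tf, al]
    simp only at hab
    by_cases h : i = a
    · subst h
      simp [ph_neg, sg_neg, integral_neg, hab.ne, hab.ne', Pi.single_apply]
    · by_cases h' : i = b
      · subst h'
        simp [ph_neg, sg_neg, integral_neg, hab.ne, hab.ne', Pi.single_apply]
      · simp [h, h', Ne.symm h, Ne.symm h', Pi.single_apply]

def sb (e : Bool) : ℝ := if e then 1 else -1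

lemma half_ind (y : Fin (d + 1) → ℝ) (e : Bool) (x : EuclideanSpace ℝ (Fin d)) (hx : ph y x ≠ 0) :
    (halfSpace (na y) (y (Fin.last d)) e).indicator (fun _ => (1 : ℝ)) x =
      (1 + sb e * sg (ph y x)) / 2 := by
  have hmem : x ∈ halfSpace (na y) (y (Fin.last d)) e ↔ if e then 0 < ph y x else ph y x < 0 := by
    cases e
    · simp only [halfSpace, ph] at hx ⊢
      simp only [Bool.false_eq_true, if_false, Set.mem_setOf_eq, sub_neg]
      exact ⟨fun h => lt_of_le_of_ne h fun h' => hx (by linarith), fun h => h.le⟩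
    · simp only [halfSpace, ph] at hx ⊢
      simp only [if_true, Set.mem_setOf_eq, sub_pos]
      exact ⟨fun h => lt_of_le_of_ne h fun h' => hx (by linarith), fun h => h.le⟩
  classical
  rw [Set.indicator_apply, if_congr hmem rfl rfl]
  rcases lt_or_gt_of_ne hx with h | h
  · cases e <;> simp [sb, sg, h, not_lt.mpr h.le]
  · cases e <;> simp [sb, sg, h, not_lt.mpr h.le]

lemma half_meas (y : Fin (d + 1) → ℝ) (e : Bool) :
    MeasurableSet (halfSpace (na y) (y (Fin.last d)) e) := by
  unfold halfSpace
  have hc : Continuous fun x : EuclideanSpace ℝ (Fin d) => (⟪na y, x⟫ : ℝ) :=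
    continuous_const.inner continuous_id
  cases e
  · simpa using (isClosed_le hc continuous_const).measurableSet
  · simpa using (isClosed_le continuous_const hc).measurableSet

lemma quarter (μ : Measure (EuclideanSpace ℝ (Fin d))) [IsFiniteMeasure μ] (hac : μ ≪ volume)
    (y z : Fin (d + 1) → ℝ) (hy : y ≠ 0) (hz : z ≠ 0)
    (h1 : ∫ x, sg (ph y x) ∂μ = 0) (h2 : ∫ x, sg (ph z x) ∂μ = 0)
    (h3 : ∫ x, sg (ph y x) * sg (ph z x) ∂μ = 0) (e e' : Bool) :
    μ (halfSpace (na y) (y (Fin.last d)) e ∩ halfSpace (na z) (z (Fin.last d)) e') =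
      μ Set.univ / 2 ^ 2 := by
  set A := halfSpace (na y) (y (Fin.last d)) e
  set B := halfSpace (na z) (z (Fin.last d)) e'
  have hm : MeasurableSet (A ∩ B) := (half_meas y e).inter (half_meas z e')
  have i1 : Integrable (fun x => sg (ph y x)) μ :=
    Integrable.of_bound (sgph_meas y).aestronglyMeasurable 1
      (Filter.Eventually.of_forall fun x => sg_abs _)
  have i2 : Integrable (fun x => sg (ph z x)) μ :=
    Integrable.of_bound (sgph_meas z).aestronglyMeasurable 1
      (Filter.Eventually.of_forall fun x => sg_abs _)
  have i3 : Integrable (fun x => sg (ph y x) * sg (ph z x)) μ :=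
    Integrable.of_bound ((sgph_meas y).mul (sgph_meas z)).aestronglyMeasurable 1
      (Filter.Eventually.of_forall fun x => sg_abs2 _ _)
  have key : μ.real (A ∩ B) = μ.real Set.univ / 4 := by
    rw [← integral_indicator_one hm]
    have : ∫ x, (A ∩ B).indicator 1 x ∂μ = ∫ x, ((1 / 4 + sb e / 4 * sg (ph y x))
        + sb e' / 4 * sg (ph z x)) + sb e * sb e' / 4 * (sg (ph y x) * sg (ph z x)) ∂μ := by
      apply integral_congr_ae
      filter_upwards [null_hyper μ hac hy, null_hyper μ hac hz] with x hx hx'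
      have ha := half_ind y e x hx
      have hb := half_ind z e' x hx'
      have : (A ∩ B).indicator (1 : EuclideanSpace ℝ (Fin d) → ℝ) x =
          A.indicator (fun _ => 1) x * B.indicator (fun _ => 1) x := by
        rw [Set.inter_indicator_one]
        rfl
      rw [this, ha, hb]
      ring
    rw [this, integral_add, integral_add, integral_add]
    · simp only [integral_const_mul, h1, h2, h3, integral_const]
      simp
      ring
    all_goals fun_prop
  have hfin : μ Set.univ / 2 ^ 2 ≠ ⊤ := by
    exact ENNReal.div_ne_top (measure_ne_top _ _) (by simp)
  rw [← ENNReal.toReal_eq_toReal_iff' (measure_ne_top _ _) hfin, ENNReal.toReal_div]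
  simp only [Measure.real] at key
  rw [key]
  norm_num

lemma na_ne (μ : Measure (EuclideanSpace ℝ (Fin d))) [IsFiniteMeasure μ] (hμ : μ ≠ 0)
    (y : Fin (d + 1) → ℝ) (hy : y ≠ 0) (h1 : ∫ x, sg (ph y x) ∂μ = 0) : na y ≠ 0 := by
  intro h
  have h0 := last_ne hy h
  have hu : μ.real Set.univ ≠ 0 := by
    rw [Measure.real, ENNReal.toReal_ne_zero]
    exact ⟨by simpa using hμ, measure_ne_top _ _⟩
  simp only [ph, h, inner_zero_left, zero_sub, integral_const, smul_eq_mul, sg_neg] at h1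
  have := (mul_eq_zero.mp h1).resolve_left hu
  rcases lt_or_gt_of_ne h0 with h | h
  · simp [sg, h, not_lt.mpr h.le] at this
  · simp [sg, h] at this

theorem main (q s k : ℕ) (hk : 2 ≤ k) (hs : s < 2 ^ q) (m d : ℕ) (hm : m = 2 ^ q + s)
    (hd : d = 2 ^ q * k + s) (μ : Fin m → Measure (EuclideanSpace ℝ (Fin d)))
    (hfin : ∀ r, IsFiniteMeasure (μ r)) (hac : ∀ r, μ r ≪ volume) :
    ∃ (a : Fin k → EuclideanSpace ℝ (Fin d)) (b : Fin k → ℝ),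
      (∀ i, a i ≠ 0) ∧
      ∀ r : Fin m, ∀ s : Finset (Fin k), s.card = 2 → ∀ ε : Fin k → Bool,
        μ r (region a b s ε) = μ r Set.univ / 2 ^ 2 := by
  subst hm hd
  by_cases h0 : ∀ r, μ r = 0
  · have hpos : 0 < 2 ^ q * k + s := by positivity
    refine ⟨fun _ => EuclideanSpace.single ⟨0, hpos⟩ 1, 0, fun _ => ?_, ?_⟩
    · simp
    · intro r s _ ε
      simp [h0 r]
  · push Not at h0
    obtain ⟨r0, hr0⟩ := h0
    obtain ⟨p, hp, hz⟩ := borsuk_ulam_app q s k (by omega) hs (tf μ) (by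
      rintro ⟨r, i | ⟨⟨i, j⟩, hij⟩⟩
      · have := hfin r
        exact cont_one (μ r) (hac r) i
      · have := hfin r
        exact cont_two (μ r) (hac r) i j) (fun j i p _ => tf_odd μ j i p)
    refine ⟨fun i => na (p i), fun i => p i (Fin.last _), fun i => ?_, ?_⟩
    · have := hfin r0
      exact na_ne (μ r0) hr0 (p i) (K_ne hp i) (hz (r0, Sum.inl i))
    · intro r S hS ε
      have := hfin r
      have hlt : ∀ i j : Fin k, i < j → μ r (region (fun i => na (p i))
          (fun i => p i (Fin.last _)) {i, j} ε) = μ r Set.univ / 2 ^ 2 := by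
        intro i j hij
        have := quarter (μ r) (hac r) (p i) (p j) (K_ne hp i) (K_ne hp j) (hz (r, Sum.inl i))
          (hz (r, Sum.inl j)) (hz (r, Sum.inr ⟨(i, j), hij⟩)) (ε i) (ε j)
        rw [← this, region]
        simp
      obtain ⟨i, j, hij, rfl⟩ := Finset.card_eq_two.mp hS
      rcases lt_or_gt_of_ne hij with h | h
      · exact hlt i j h
      · rw [Finset.pair_comm]
        exact hlt j i h

end BU

theorem stmt_0 (q t k : ℕ) (ht1 : 1 ≤ t) (ht2 : t ≤ 2 ^ q) (hk : 2 ≤ k)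
    (m d : ℕ) (hm : m = 2 ^ (q + 1) - t) (hd : d = 2 ^ q * (k + 1) - t)
    (μ : Fin m → Measure (EuclideanSpace ℝ (Fin d)))
    (hfin : ∀ r, IsFiniteMeasure (μ r))
    (hac : ∀ r, μ r ≪ volume) :
    ∃ (a : Fin k → EuclideanSpace ℝ (Fin d)) (b : Fin k → ℝ),
      (∀ i, a i ≠ 0) ∧
      ∀ r : Fin m, ∀ s : Finset (Fin k), s.card = 2 → ∀ ε : Fin k → Bool,
        μ r (region a b s ε) = μ r Set.univ / 2 ^ 2 := by
  refine BU.main q (2 ^ q - t) k hk (by omega) m d ?_ ?_ μ hfin hac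
  · rw [hm, pow_succ]
    omega
  · rw [hd, mul_add, mul_one]
    omega
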